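/- arXiv:2411.07538 — 2 statements merged into one kernel-verified Lean document; each statement's English description precedes it below -/
import Mathlib

section
/- For the Softmax-attention kernel, the map W^K ↦ S_i(W^Q, W^K; X_i) = [Softmax(C_{i1}), …, Softmax(C_{iH})] is Fréchet differentiable, and its differential satisfies ‖dS_i‖_F ≤ ψ_i ‖dW^K‖_F for every perturbation dW^K of the collected key weights, where ψ_i = (n/√d) ‖X_i‖_F² √(Σ_{h=1}^H σ_max²(W^Q_h)). -/
open scoped BigOperators
open scoped Matrix

noncomputable section

namespace Paper

/-- Euclidean (`ℓ²`) norm of a finite family of reals. -/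
def enorm {ι : Type*} [Fintype ι] (v : ι → ℝ) : ℝ := Real.sqrt (∑ i, v i ^ 2)

/-- Frobenius norm of a real matrix. -/
def frob {m k : Type*} [Fintype m] [Fintype k] (A : Matrix m k ℝ) : ℝ :=
  Real.sqrt (∑ i, ∑ j, A i j ^ 2)

/-- Largest singular value of a real matrix: `sup` of `‖A v‖₂` over unit vectors `v`. -/
def sigmaMax {m k : Type*} [Fintype m] [Fintype k] (A : Matrix m k ℝ) : ℝ :=
  sSup {c | ∃ v : k → ℝ, (∑ j, v j ^ 2) = 1 ∧ c = enorm (A.mulVec v)}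

/-- Smallest singular value of a (full row rank) real matrix:
`inf` of `‖uᵀ A‖₂` over unit vectors `u`. -/
def sigmaMin {m k : Type*} [Fintype m] [Fintype k] (A : Matrix m k ℝ) : ℝ :=
  sInf {c | ∃ u : m → ℝ, (∑ i, u i ^ 2) = 1 ∧ c = enorm (Matrix.vecMul u A)}

variable {N n D d H : ℕ}

/-- Attention logits `C = X W^Q (X W^K)ᵀ / √d`. -/
def attnC (WQ WK : Matrix (Fin D) (Fin d) ℝ) (Xi : Matrix (Fin n) (Fin D) ℝ) :
    Matrix (Fin n) (Fin n) ℝ :=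
  (Real.sqrt (d : ℝ))⁻¹ • (Xi * WQ * (Xi * WK)ᵀ)

/-- Row-wise softmax of a square matrix. -/
def softmaxMat (Z : Matrix (Fin n) (Fin n) ℝ) : Matrix (Fin n) (Fin n) ℝ :=
  Matrix.of fun k j => Real.exp (Z k j) / ∑ l, Real.exp (Z k l)

/-- Softmax attention kernel. -/
def Ssoft (WQ WK : Matrix (Fin D) (Fin d) ℝ) (Xi : Matrix (Fin n) (Fin D) ℝ) :
    Matrix (Fin n) (Fin n) ℝ :=
  softmaxMat (attnC WQ WK Xi)

/-- Gaussian attention kernel. -/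
def Sgauss (WQ WK : Matrix (Fin D) (Fin d) ℝ) (Xi : Matrix (Fin n) (Fin D) ℝ) :
    Matrix (Fin n) (Fin n) ℝ :=
  Matrix.of fun k j =>
    Real.exp (-(∑ l, (Matrix.vecMul (Xi k) WQ l - Matrix.vecMul (Xi j) WK l) ^ 2) /
      (2 * Real.sqrt (d : ℝ)))

/-- Multi-head attention output on one sample, for given head kernels `S h`. -/
def MH (S : Fin H → Matrix (Fin n) (Fin n) ℝ) (WV : Fin H → Matrix (Fin D) (Fin d) ℝ)
    (WO : Fin H → Fin d → ℝ) (Xi : Matrix (Fin n) (Fin D) ℝ) : Fin n → ℝ :=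
  fun k => ∑ h, ∑ l, (S h * Xi * WV h) k l * WO h l

/-- Squared-error loss `½ Σᵢ ‖out i − y i‖²`. -/
def lossOf (out y : Fin N → Fin n → ℝ) : ℝ :=
  (1 / 2) * ∑ i, ∑ k, (out i k - y i k) ^ 2

/-- The stacked matrix `B ∈ ℝ^{Nn × HD}` whose `(i,h)` block is `S_{ih} X_i`. -/
def Bmat (S : Fin N → Fin H → Matrix (Fin n) (Fin n) ℝ)
    (X : Fin N → Matrix (Fin n) (Fin D) ℝ) :
    Matrix (Fin N × Fin n) (Fin H × Fin D) ℝ :=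
  Matrix.of fun ik hp => (S ik.1 hp.1 * X ik.1) ik.2 hp.2

/-- Block-diagonal stacked value matrix `W^V = diag(W^V_1, …, W^V_H)`. -/
def diagWV (WV : Fin H → Matrix (Fin D) (Fin d) ℝ) :
    Matrix (Fin H × Fin D) (Fin H × Fin d) ℝ :=
  Matrix.of fun hp hq => if hp.1 = hq.1 then WV hp.1 hp.2 hq.2 else 0

/-- Euclidean norm of the output weight `W^O ∈ ℝ^{Hd×1}`. -/
def WOnorm (WO : Fin H → Fin d → ℝ) : ℝ := enorm fun hl : Fin H × Fin d => WO hl.1 hl.2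

/-- Frobenius norm of the row-stacked data matrix `X ∈ ℝ^{Nn×D}`. -/
def XF (X : Fin N → Matrix (Fin n) (Fin D) ℝ) : ℝ :=
  Real.sqrt (∑ i, ∑ k, ∑ p, X i k p ^ 2)

/-- The `h`-th head matrix of a packed head-indexed parameter vector. -/
def headMat (v : EuclideanSpace ℝ (Fin H × Fin D × Fin d)) (h : Fin H) :
    Matrix (Fin D) (Fin d) ℝ :=
  Matrix.of fun p q => v (h, p, q)

/-- Index type for the full parameter set `M = (W^Q, W^K, W^V)`. -/
abbrev FullIdx (H D d : ℕ) := Fin 3 × Fin H × Fin D × Fin d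

/-- Query weights of the packed full parameter vector. -/
def mQ (v : EuclideanSpace ℝ (FullIdx H D d)) (h : Fin H) : Matrix (Fin D) (Fin d) ℝ :=
  Matrix.of fun p q => v (0, h, p, q)

/-- Key weights of the packed full parameter vector. -/
def mK (v : EuclideanSpace ℝ (FullIdx H D d)) (h : Fin H) : Matrix (Fin D) (Fin d) ℝ :=
  Matrix.of fun p q => v (1, h, p, q)

/-- Value weights of the packed full parameter vector. -/
def mV (v : EuclideanSpace ℝ (FullIdx H D d)) (h : Fin H) : Matrix (Fin D) (Fin d) ℝ :=
  Matrix.of fun p q => v (2, h, p, q)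

/-- A packed `D × d` parameter vector as a matrix. -/
def toMat2 {D d : ℕ} (w : EuclideanSpace ℝ (Fin D × Fin d)) : Matrix (Fin D) (Fin d) ℝ :=
  Matrix.of fun p q => w (p, q)

/-- The squared norm of `A v` is at most `sigmaMax A ^ 2` times that of `v`. -/
lemma sum_mulVec_sq_le {m k : Type*} [Fintype m] [Fintype k] (A : Matrix m k ℝ) (v : k → ℝ) :
    ∑ i, (A.mulVec v) i ^ 2 ≤ sigmaMax A ^ 2 * ∑ j, v j ^ 2 := by
  have hs : 0 ≤ ∑ j, v j ^ 2 := Finset.sum_nonneg fun j _ => sq_nonneg _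
  rcases hs.eq_or_lt with h0 | hpos
  · have hv : v = 0 := by
      funext j
      have := (Finset.sum_eq_zero_iff_of_nonneg (fun j _ => sq_nonneg (v j))).1 h0.symm j
        (Finset.mem_univ j)
      simpa using this
    subst hv
    simp
  · set s := ∑ j, v j ^ 2 with hsdef
    have hbdd : BddAbove {c | ∃ v : k → ℝ, (∑ j, v j ^ 2) = 1 ∧ c = enorm (A.mulVec v)} := by
      refine ⟨Real.sqrt (∑ i, ∑ j, A i j ^ 2), ?_⟩
      rintro c ⟨u, hu, rfl⟩
      apply Real.sqrt_le_sqrt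
      apply Finset.sum_le_sum
      intro i _
      have := Finset.sum_mul_sq_le_sq_mul_sq Finset.univ (fun j => A i j) u
      rw [hu, mul_one] at this
      exact this
    have hr : 0 < Real.sqrt s := Real.sqrt_pos.2 hpos
    have hr2 : Real.sqrt s ^ 2 = s := Real.sq_sqrt hs
    have hmem : enorm (A.mulVec ((Real.sqrt s)⁻¹ • v)) ≤ sigmaMax A := by
      apply le_csSup hbdd
      refine ⟨_, ?_, rfl⟩
      simp only [Pi.smul_apply, smul_eq_mul, mul_pow, ← Finset.mul_sum, inv_pow, hr2]
      rw [← hsdef]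
      exact inv_mul_cancel₀ hpos.ne'
    have h2 : enorm (A.mulVec ((Real.sqrt s)⁻¹ • v)) ^ 2 ≤ sigmaMax A ^ 2 :=
      pow_le_pow_left₀ (Real.sqrt_nonneg _) hmem 2
    rw [enorm, Real.sq_sqrt (Finset.sum_nonneg fun j _ => sq_nonneg _), Matrix.mulVec_smul] at h2
    simp only [Pi.smul_apply, smul_eq_mul, mul_pow, ← Finset.mul_sum, inv_pow, hr2] at h2
    rwa [inv_mul_le_iff₀ hpos, mul_comm] at h2

/-- Softmax Jacobian contraction. -/
lemma softmax_jac_le {n : ℕ} (p c : Fin n → ℝ) (hp : ∀ j, 0 ≤ p j) (hs : ∑ j, p j = 1) :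
    ∑ j, (p j * (c j - ∑ l, p l * c l)) ^ 2 ≤ ∑ j, c j ^ 2 := by
  have hp1 : ∀ j, p j ≤ 1 := fun j => by
    rw [← hs]; exact Finset.single_le_sum (fun i _ => hp i) (Finset.mem_univ j)
  set m := ∑ l, p l * c l with hm
  clear_value m
  calc ∑ j, (p j * (c j - m)) ^ 2 ≤ ∑ j, p j * (c j - m) ^ 2 := by
        apply Finset.sum_le_sum
        intro j _
        have : p j ^ 2 ≤ p j := by nlinarith [hp j, hp1 j]
        rw [mul_pow]
        exact mul_le_mul_of_nonneg_right this (sq_nonneg _)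
    _ = ∑ j, p j * c j ^ 2 - 2 * m * ∑ j, p j * c j + m ^ 2 * ∑ j, p j := by
        rw [Finset.mul_sum, Finset.mul_sum, ← Finset.sum_sub_distrib, ← Finset.sum_add_distrib]
        apply Finset.sum_congr rfl
        intros; ring
    _ ≤ ∑ j, p j * c j ^ 2 := by
        rw [hs, ← hm]; nlinarith [sq_nonneg m]
    _ ≤ ∑ j, c j ^ 2 := by
        apply Finset.sum_le_sum
        intro j _
        nlinarith [hp1 j, sq_nonneg (c j)]

/-- Frobenius bound for the logits. -/
lemma attnC_sq_le {n D d : ℕ} (WQ W : Matrix (Fin D) (Fin d) ℝ) (Xi : Matrix (Fin n) (Fin D) ℝ) :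
    ∑ k, ∑ j, attnC WQ W Xi k j ^ 2 ≤
      ((Real.sqrt (d : ℝ))⁻¹) ^ 2 * ((∑ k, ∑ p, Xi k p ^ 2) ^ 2 *
        (sigmaMax WQ ^ 2 * ∑ p, ∑ q, W p q ^ 2)) := by
  set F := ∑ k, ∑ p, Xi k p ^ 2 with hF
  set G := ∑ p, ∑ q, W p q ^ 2 with hG
  have hF0 : 0 ≤ F := Finset.sum_nonneg fun _ _ => Finset.sum_nonneg fun _ _ => sq_nonneg _
  have key : ∀ k j, attnC WQ W Xi k j =
      (Real.sqrt (d : ℝ))⁻¹ * ∑ p, Xi k p * (WQ.mulVec (Matrix.vecMul (Xi j) W)) p := by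
    intro k j
    have : (Xi * WQ * (Xi * W)ᵀ) k j = ∑ p, Xi k p * (WQ.mulVec (Matrix.vecMul (Xi j) W)) p := by
      rw [Matrix.mul_assoc, Matrix.mul_apply]
      rfl
    rw [attnC, Matrix.smul_apply, this, smul_eq_mul]
  have hu : ∀ j, ∑ q, (Matrix.vecMul (Xi j) W) q ^ 2 ≤ (∑ p, Xi j p ^ 2) * G := by
    intro j
    rw [hG, Finset.sum_comm, Finset.mul_sum]
    apply Finset.sum_le_sum
    intro q _
    exact Finset.sum_mul_sq_le_sq_mul_sq Finset.univ (fun p => Xi j p) (fun p => W p q)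
  calc ∑ k, ∑ j, attnC WQ W Xi k j ^ 2
      ≤ ∑ k, ∑ j, ((Real.sqrt (d : ℝ))⁻¹) ^ 2 * ((∑ p, Xi k p ^ 2) *
          (sigmaMax WQ ^ 2 * ((∑ p, Xi j p ^ 2) * G))) := by
        apply Finset.sum_le_sum; intro k _
        apply Finset.sum_le_sum; intro j _
        rw [key, mul_pow]
        apply mul_le_mul_of_nonneg_left _ (sq_nonneg _)
        refine (Finset.sum_mul_sq_le_sq_mul_sq Finset.univ _ _).trans ?_
        apply mul_le_mul_of_nonneg_left _ (Finset.sum_nonneg fun _ _ => sq_nonneg _)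
        refine (sum_mulVec_sq_le _ _).trans ?_
        exact mul_le_mul_of_nonneg_left (hu j) (sq_nonneg _)
    _ = _ := by
        simp only [← Finset.mul_sum, ← Finset.sum_mul]
        rw [← hF]; ring

lemma attnC_line {n D d H : ℕ} (WQ : Matrix (Fin D) (Fin d) ℝ) (Xi : Matrix (Fin n) (Fin D) ℝ)
    (v w : EuclideanSpace ℝ (Fin H × Fin D × Fin d)) (h : Fin H) (t : ℝ) (k j : Fin n) :
    attnC WQ (headMat (v + t • w) h) Xi k j =
      attnC WQ (headMat v h) Xi k j + t * attnC WQ (headMat w h) Xi k j := by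
  have : headMat (v + t • w) h = headMat v h + t • headMat w h := by
    ext p q; simp [headMat]
  rw [this]
  simp [attnC, Matrix.mul_add]
  ring

lemma softmax_line_deriv {n : ℕ} (a c : Fin n → ℝ) (j : Fin n) :
    HasDerivAt (fun t : ℝ => Real.exp (a j + t * c j) / ∑ l, Real.exp (a l + t * c l))
      (Real.exp (a j) / (∑ l, Real.exp (a l)) *
        (c j - ∑ l, Real.exp (a l) / (∑ l, Real.exp (a l)) * c l)) 0 := by
  have he : ∀ l, HasDerivAt (fun t : ℝ => Real.exp (a l + t * c l)) (Real.exp (a l) * c l) 0 := by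
    intro l
    have := (((hasDerivAt_id (0 : ℝ)).mul_const (c l)).const_add (a l)).exp
    simpa using this
  have hpos : 0 < ∑ l, Real.exp (a l) :=
    Finset.sum_pos (fun _ _ => Real.exp_pos _) ⟨j, Finset.mem_univ j⟩
  have hsum : HasDerivAt (fun t : ℝ => ∑ l, Real.exp (a l + t * c l))
      (∑ l, Real.exp (a l) * c l) 0 := HasDerivAt.fun_sum fun l _ => he l
  have := (he j).fun_div hsum (by simpa using hpos.ne')
  refine this.congr_deriv ?_
  simp only [zero_mul, add_zero]
  symm
  have : ∑ l, Real.exp (a l) / (∑ l, Real.exp (a l)) * c l =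
      (∑ l, Real.exp (a l) * c l) / ∑ l, Real.exp (a l) := by
    rw [Finset.sum_div]
    exact Finset.sum_congr rfl fun l _ => by ring
  rw [this]
  field_simp

/-- Lemma 2(2) of the paper. The Softmax attention kernel
`W^K ↦ S_i(W^Q, W^K; X_i)` is (Fréchet) differentiable, and its differential satisfies
`‖dS_i‖_F ≤ ψ_i ‖dW^K‖_F` with `ψ_i = (n/√d) ‖X_i‖_F² √(Σ_h σ_max²(W^Q_h))`. -/
theorem softmax_kernel_key_differential_bound
    {n D d H : ℕ}
    (Xi : Matrix (Fin n) (Fin D) ℝ)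
    (WQ : Fin H → Matrix (Fin D) (Fin d) ℝ)
    (g : EuclideanSpace ℝ (Fin H × Fin D × Fin d) → EuclideanSpace ℝ (Fin n × Fin H × Fin n))
    (hg : g = fun v => (EuclideanSpace.equiv (Fin n × Fin H × Fin n) ℝ).symm
      fun khj => Ssoft (WQ khj.2.1) (headMat v khj.2.1) Xi khj.1 khj.2.2) :
    Differentiable ℝ g ∧
      ∀ (v dWK : EuclideanSpace ℝ (Fin H × Fin D × Fin d)),
        ‖fderiv ℝ g v dWK‖ ≤
          ((n : ℝ) / Real.sqrt (d : ℝ)) * frob Xi ^ 2 *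
            Real.sqrt (∑ h, sigmaMax (WQ h) ^ 2) * ‖dWK‖ := by
  have hcoord : ∀ v khj, g v khj = Ssoft (WQ khj.2.1) (headMat v khj.2.1) Xi khj.1 khj.2.2 := by
    intro v khj; rw [hg]; rfl
  have hdiff : Differentiable ℝ g := by
    rw [differentiable_euclidean]
    rintro ⟨k, h, j⟩
    have hC : ∀ l, Differentiable ℝ (fun v : EuclideanSpace ℝ (Fin H × Fin D × Fin d) =>
        attnC (WQ h) (headMat v h) Xi k l) := by
      intro l
      simp only [attnC, headMat, Matrix.smul_apply, Matrix.mul_apply, Matrix.transpose_apply,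
        Matrix.of_apply, smul_eq_mul]
      fun_prop
    have heq : (fun v => g v (k, h, j)) = fun v => Real.exp (attnC (WQ h) (headMat v h) Xi k j) /
        ∑ l, Real.exp (attnC (WQ h) (headMat v h) Xi k l) := by
      funext v; rw [hcoord]; rfl
    rw [heq]
    have hsum : Differentiable ℝ (fun v : EuclideanSpace ℝ (Fin H × Fin D × Fin d) =>
        ∑ l, Real.exp (attnC (WQ h) (headMat v h) Xi k l)) :=
      Differentiable.fun_sum fun l _ => (hC l).exp
    intro v
    simp only [div_eq_mul_inv]
    refine ((hC j).exp v).fun_mul ((hsum v).fun_inv ?_)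
    exact (Finset.sum_pos (fun _ _ => Real.exp_pos _) ⟨j, Finset.mem_univ j⟩).ne'
  refine ⟨hdiff, fun v w => ?_⟩
  set P : Fin n → Fin H → Fin n → ℝ := fun k h j => Ssoft (WQ h) (headMat v h) Xi k j with hP
  set C : Fin n → Fin H → Fin n → ℝ := fun k h j => attnC (WQ h) (headMat w h) Xi k j with hCdef
  have hder : ∀ k h j, fderiv ℝ g v w (k, h, j) =
      P k h j * (C k h j - ∑ l, P k h l * C k h l) := by
    intro k h j
    have hline : HasDerivAt (fun t : ℝ => v + t • w) w 0 := by
      simpa using ((hasDerivAt_id (0 : ℝ)).smul_const w).const_add v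
    have hg0 : HasFDerivAt g (fderiv ℝ g v) (v + (0 : ℝ) • w) := by
      simpa using (hdiff v).hasFDerivAt
    have h1 := hg0.comp_hasDerivAt (0 : ℝ) hline
    have h2 : HasDerivAt (fun t : ℝ => g (v + t • w) (k, h, j)) (fderiv ℝ g v w (k, h, j)) 0 :=
      ((EuclideanSpace.proj (𝕜 := ℝ) (k, h, j)).hasFDerivAt.comp_hasDerivAt (0 : ℝ) h1)
    have h3 := softmax_line_deriv (fun l => attnC (WQ h) (headMat v h) Xi k l) (C k h) j
    have heq : (fun t : ℝ => g (v + t • w) (k, h, j)) = fun t : ℝ =>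
        Real.exp (attnC (WQ h) (headMat v h) Xi k j + t * C k h j) /
          ∑ l, Real.exp (attnC (WQ h) (headMat v h) Xi k l + t * C k h l) := by
      funext t
      rw [hcoord]
      simp only [Ssoft, softmaxMat, Matrix.of_apply, attnC_line, hCdef]
    rw [heq] at h2
    exact h2.unique h3
  have hP0 : ∀ k h j, 0 ≤ P k h j := fun k h j =>
    div_nonneg (Real.exp_pos _).le (Finset.sum_nonneg fun _ _ => (Real.exp_pos _).le)
  have hP1 : ∀ k h, ∑ j, P k h j = 1 := by
    intro k h
    have hpos : 0 < ∑ l, Real.exp (attnC (WQ h) (headMat v h) Xi k l) :=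
      Finset.sum_pos (fun _ _ => Real.exp_pos _) ⟨k, Finset.mem_univ k⟩
    simp only [hP, Ssoft, softmaxMat, Matrix.of_apply]
    rw [← Finset.sum_div]
    exact div_self hpos.ne'
  have hF0 : 0 ≤ ∑ k, ∑ p, Xi k p ^ 2 :=
    Finset.sum_nonneg fun _ _ => Finset.sum_nonneg fun _ _ => sq_nonneg _
  have hfrob : frob Xi ^ 2 = ∑ k, ∑ p, Xi k p ^ 2 := Real.sq_sqrt hF0
  set F := ∑ k, ∑ p, Xi k p ^ 2 with hF
  have hw : ‖w‖ ^ 2 = ∑ h, ∑ p, ∑ q, headMat w h p q ^ 2 := by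
    rw [EuclideanSpace.real_norm_sq_eq, Fintype.sum_prod_type]
    simp only [Fintype.sum_prod_type]
    rfl
  have hS0 : 0 ≤ ∑ h, sigmaMax (WQ h) ^ 2 := Finset.sum_nonneg fun _ _ => sq_nonneg _
  have hmain : ‖fderiv ℝ g v w‖ ^ 2 ≤
      ((Real.sqrt (d : ℝ))⁻¹ * F * Real.sqrt (∑ h, sigmaMax (WQ h) ^ 2) * ‖w‖) ^ 2 := by
    calc ‖fderiv ℝ g v w‖ ^ 2
        = ∑ k, ∑ h, ∑ j, (P k h j * (C k h j - ∑ l, P k h l * C k h l)) ^ 2 := by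
          rw [EuclideanSpace.real_norm_sq_eq, Fintype.sum_prod_type]
          simp only [Fintype.sum_prod_type, hder]
      _ ≤ ∑ k, ∑ h, ∑ j, C k h j ^ 2 :=
          Finset.sum_le_sum fun k _ => Finset.sum_le_sum fun h _ =>
            softmax_jac_le _ _ (hP0 k h) (hP1 k h)
      _ = ∑ h, ∑ k, ∑ j, C k h j ^ 2 := Finset.sum_comm
      _ ≤ ∑ h, ((Real.sqrt (d : ℝ))⁻¹) ^ 2 * (F ^ 2 *
            (sigmaMax (WQ h) ^ 2 * ∑ p, ∑ q, headMat w h p q ^ 2)) :=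
          Finset.sum_le_sum fun h _ => attnC_sq_le (WQ h) (headMat w h) Xi
      _ ≤ ∑ h, ((Real.sqrt (d : ℝ))⁻¹) ^ 2 * (F ^ 2 * (sigmaMax (WQ h) ^ 2 * ‖w‖ ^ 2)) := by
          apply Finset.sum_le_sum
          intro h _
          have : ∑ p, ∑ q, headMat w h p q ^ 2 ≤ ‖w‖ ^ 2 := by
            rw [hw]
            exact Finset.single_le_sum (f := fun h => ∑ p, ∑ q, headMat w h p q ^ 2)
              (fun _ _ => Finset.sum_nonneg fun _ _ => Finset.sum_nonneg fun _ _ => sq_nonneg _)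
              (Finset.mem_univ h)
          gcongr
      _ = _ := by
          simp only [← Finset.mul_sum, ← Finset.sum_mul]
          rw [mul_pow, mul_pow, mul_pow, Real.sq_sqrt hS0]
          ring
  rcases Nat.eq_zero_or_pos n with hn | hn
  · subst hn
    have : fderiv ℝ g v w = 0 := Subsingleton.elim _ _
    rw [this]
    simp
  · have h1 : ‖fderiv ℝ g v w‖ ≤
        (Real.sqrt (d : ℝ))⁻¹ * F * Real.sqrt (∑ h, sigmaMax (WQ h) ^ 2) * ‖w‖ :=
      (sq_le_sq₀ (norm_nonneg _) (by positivity)).1 hmain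
    refine h1.trans ?_
    rw [hfrob]
    have hn1 : (1 : ℝ) ≤ n := by exact_mod_cast hn
    have : (Real.sqrt (d : ℝ))⁻¹ ≤ (n : ℝ) / Real.sqrt (d : ℝ) := by
      rw [div_eq_mul_inv]
      exact le_mul_of_one_le_left (by positivity) hn1
    gcongr

end Paper
end
end

section
/- For the Gaussian-kernel Transformer, on any region of parameter space where σ_max(W^Q_h), σ_max(W^K_h) (for all h) and σ_max(W^V) are bounded by a fixed constant R, the gradient of the loss is Lipschitz: there exists a constant G′ > 0 (depending only on the data X, y, W^O, N, n, H, d and R) such that for any two parameter sets M, M′ in this region, ‖∇_M f(M; X) − ∇_M f(M′; X)‖₂ ≤ G′ ‖M − M′‖_F. -/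
open scoped BigOperators
open scoped Matrix

noncomputable section

namespace Paper

variable {N n D d H : ℕ}

theorem abs_entry_le_sigmaMax {m k : Type*} [Fintype m] [Fintype k]
    (A : Matrix m k ℝ) (i : m) (j : k) : |A i j| ≤ sigmaMax A := by
  classical
  have hb : BddAbove {c | ∃ v : k → ℝ, (∑ j, v j ^ 2) = 1 ∧ c = enorm (A.mulVec v)} := by
    refine ⟨Real.sqrt (∑ i, (∑ j, |A i j|) ^ 2), ?_⟩
    rintro c ⟨v, hv, rfl⟩
    unfold enorm
    apply Real.sqrt_le_sqrt
    refine Finset.sum_le_sum fun i _ => ?_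
    have hle : |A.mulVec v i| ≤ ∑ j, |A i j| := by
      simp only [Matrix.mulVec, dotProduct]
      refine (Finset.abs_sum_le_sum_abs _ _).trans (Finset.sum_le_sum fun j _ => ?_)
      rw [abs_mul]
      have h1 : v j ^ 2 ≤ 1 := by
        rw [← hv]
        exact Finset.single_le_sum (f := fun j => v j ^ 2) (fun j _ => sq_nonneg _)
          (Finset.mem_univ j)
      have h2 : |v j| ≤ 1 := by
        rw [← sq_le_one_iff_abs_le_one]; exact h1
      exact mul_le_of_le_one_right (abs_nonneg _) h2
    rw [← sq_abs]
    exact pow_le_pow_left₀ (abs_nonneg _) hle 2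
  have hmem : enorm (A.mulVec (Pi.single j 1)) ≤ sigmaMax A := by
    refine le_csSup hb ⟨Pi.single j 1, ?_, rfl⟩
    simp [Pi.single_apply]
  refine le_trans ?_ hmem
  unfold enorm
  rw [← Real.sqrt_sq_eq_abs]
  apply Real.sqrt_le_sqrt
  have := Finset.single_le_sum (f := fun i => (A.mulVec (Pi.single j 1) i) ^ 2)
    (fun j _ => sq_nonneg _) (Finset.mem_univ i)
  simpa using this

theorem norm_le_of_region {D d H : ℕ} (R : ℝ) (v : EuclideanSpace ℝ (FullIdx H D d))
    (hQ : ∀ h, sigmaMax (mQ v h) ≤ R) (hK : ∀ h, sigmaMax (mK v h) ≤ R)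
    (hV : sigmaMax (diagWV (mV v)) ≤ R) :
    ‖v‖ ≤ Real.sqrt (∑ _i : FullIdx H D d, R ^ 2) := by
  rw [EuclideanSpace.norm_eq]
  apply Real.sqrt_le_sqrt
  refine Finset.sum_le_sum fun i _ => ?_
  refine pow_le_pow_left₀ (norm_nonneg _) ?_ 2
  obtain ⟨a, h, p, q⟩ := i
  rw [Real.norm_eq_abs]
  fin_cases a
  · exact (abs_entry_le_sigmaMax (mQ v h) p q).trans (hQ h)
  · exact (abs_entry_le_sigmaMax (mK v h) p q).trans (hK h)
  · have := (abs_entry_le_sigmaMax (diagWV (mV v)) (h, p) (h, q)).trans hV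
    simpa [diagWV, mV] using this

theorem contDiff_loss {N n D d H : ℕ}
    (X : Fin N → Matrix (Fin n) (Fin D) ℝ) (y : Fin N → Fin n → ℝ)
    (WO : Fin H → Fin d → ℝ) :
    ContDiff ℝ 2 (fun v : EuclideanSpace ℝ (FullIdx H D d) =>
      lossOf (fun i => MH (fun h => Sgauss (mQ v h) (mK v h) (X i)) (mV v) WO (X i)) y) := by
  have hc : ∀ i : FullIdx H D d,
      ContDiff ℝ 2 (fun v : EuclideanSpace ℝ (FullIdx H D d) => v i) := fun i => by fun_prop
  simp only [lossOf, MH, Sgauss, mQ, mK, mV, Matrix.mul_apply, Matrix.of_apply, Matrix.vecMul,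
    dotProduct]
  fun_prop

/-- Lemma 10(2) of the paper. On a region where all singular values of
`W^Q_h`, `W^K_h` and `W^V` are bounded by `R`, the gradient of the Gaussian-kernel
Transformer loss is Lipschitz: `‖∇f(M;X) − ∇f(M′;X)‖₂ ≤ G′ ‖M − M′‖_F` for some `G′ > 0`. -/
theorem gaussian_gradient_lipschitz
    {N n D d H : ℕ}
    (X : Fin N → Matrix (Fin n) (Fin D) ℝ) (y : Fin N → Fin n → ℝ)
    (WO : Fin H → Fin d → ℝ)
    (f : EuclideanSpace ℝ (FullIdx H D d) → ℝ)
    (hf : f = fun v =>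
      lossOf (fun i => MH (fun h => Sgauss (mQ v h) (mK v h) (X i)) (mV v) WO (X i)) y)
    (R : ℝ) :
    ∃ G' : ℝ, 0 < G' ∧
      ∀ v v' : EuclideanSpace ℝ (FullIdx H D d),
        (∀ h, sigmaMax (mQ v h) ≤ R) → (∀ h, sigmaMax (mK v h) ≤ R) →
        sigmaMax (diagWV (mV v)) ≤ R →
        (∀ h, sigmaMax (mQ v' h) ≤ R) → (∀ h, sigmaMax (mK v' h) ≤ R) →
        sigmaMax (diagWV (mV v')) ≤ R →
        ‖gradient f v - gradient f v'‖ ≤ G' * ‖v - v'‖ := by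
  have hC : ContDiff ℝ 2 f := hf ▸ contDiff_loss X y WO
  have hC1 : ContDiff ℝ 1 (fderiv ℝ f) := hC.fderiv_right (by norm_num)
  set r := Real.sqrt (∑ _i : FullIdx H D d, R ^ 2) with hr
  obtain ⟨C, hCb⟩ := (isCompact_closedBall (0 : EuclideanSpace ℝ (FullIdx H D d)) r)
    |>.exists_bound_of_continuousOn (hC1.continuous_fderiv (by norm_num)).continuousOn
  refine ⟨max C 1, by positivity, ?_⟩
  intro v v' hQ hK hV hQ' hK' hV'
  have hv := norm_le_of_region R v hQ hK hV
  have hv' := norm_le_of_region R v' hQ' hK' hV'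
  unfold gradient
  rw [← map_sub, LinearIsometryEquiv.norm_map]
  refine (convex_closedBall (0 : EuclideanSpace ℝ (FullIdx H D d)) r)
    |>.norm_image_sub_le_of_norm_fderiv_le (𝕜 := ℝ)
      (fun x _ => (hC1.differentiable (by norm_num)) x)
      (fun x hx => (hCb x hx).trans (le_max_left _ _)) ?_ ?_
  · exact mem_closedBall_zero_iff.2 hv'
  · exact mem_closedBall_zero_iff.2 hv


end Paper
end
end
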